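/- Let G be a bipartite planar graph with parts A and B, where every vertex of A has degree at most b. Then there is a coloring c : B → {1,...,6b} such that any two vertices of B with a common neighbor in A receive distinct colors. -/

import Mathlib

/-- `H` is a minor of `G`. -/
def IsMinor {W V : Type*} (H : SimpleGraph W) (G : SimpleGraph V) : Prop :=
  ∃ f : W → Set V,
    (∀ w, (f w).Nonempty) ∧
    (∀ w, (G.induce (f w)).Connected) ∧
    (Pairwise fun w w' => Disjoint (f w) (f w')) ∧
    (∀ w w', H.Adj w w' → ∃ a ∈ f w, ∃ b ∈ f w', G.Adj a b)

/-- A graph is planar iff it has no `K₅` and no `K₃,₃` minor (Wagner's theorem). -/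
def IsPlanar {V : Type*} (G : SimpleGraph V) : Prop :=
  ¬ IsMinor (⊤ : SimpleGraph (Fin 5)) G ∧
  ¬ IsMinor (completeBipartiteGraph (Fin 3) (Fin 3)) G

set_option linter.unusedVariables false
set_option linter.unusedSectionVars false
namespace BPC

lemma reach_mono {V : Type*} {G : SimpleGraph V} {s t : Set V} (h : s ⊆ t) {a b : s}
    (hr : (G.induce s).Reachable a b) :
    (G.induce t).Reachable ⟨a.1, h a.2⟩ ⟨b.1, h b.2⟩ :=
  hr.map (SimpleGraph.induceHomOfLE G h).toHom

lemma reach_union {V : Type*} {G' G : SimpleGraph V} (F : Set V) (g : V → Set V)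
    (hconn : ∀ u ∈ F, (G.induce (g u)).Connected)
    (hadj : ∀ u w, G'.Adj u w → ∃ a ∈ g u, ∃ b ∈ g w, G.Adj a b)
    (u w : F) (p : (G'.induce F).Walk u w) :
    ∀ a (ha : a ∈ g u) b (hb : b ∈ g w), (G.induce (⋃ u ∈ F, g u)).Reachable
      ⟨a, Set.mem_biUnion u.2 ha⟩ ⟨b, Set.mem_biUnion w.2 hb⟩ := by
  induction p with
  | @nil u =>
    intro a ha b hb
    exact reach_mono (Set.subset_biUnion_of_mem u.2)
      ((hconn u u.2).preconnected ⟨a, ha⟩ ⟨b, hb⟩)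
  | @cons u u' w h p ih =>
    intro a ha b hb
    obtain ⟨q, hq, r, hr, hqr⟩ := hadj u u' h
    have h1 := reach_mono (Set.subset_biUnion_of_mem (u := g) u.2)
      ((hconn u u.2).preconnected ⟨a, ha⟩ ⟨q, hq⟩)
    refine h1.trans (SimpleGraph.Reachable.trans ?_ (ih r hr b hb))
    exact SimpleGraph.Adj.reachable (by simpa using hqr)

lemma conn_union {V : Type*} {G' G : SimpleGraph V} (F : Set V) (g : V → Set V)
    (hF : (G'.induce F).Connected)
    (hconn : ∀ u ∈ F, (G.induce (g u)).Connected)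
    (hadj : ∀ u w, G'.Adj u w → ∃ a ∈ g u, ∃ b ∈ g w, G.Adj a b) :
    (G.induce (⋃ u ∈ F, g u)).Connected := by
  rw [SimpleGraph.connected_iff]
  constructor
  · rintro ⟨a, ha⟩ ⟨b, hb⟩
    obtain ⟨u, hu, hau⟩ := Set.mem_iUnion₂.1 ha
    obtain ⟨w, hw, hbw⟩ := Set.mem_iUnion₂.1 hb
    obtain ⟨p⟩ := hF.preconnected ⟨u, hu⟩ ⟨w, hw⟩
    exact reach_union F g hconn hadj _ _ p a hau b hbw
  · obtain ⟨u, hu⟩ := hF.nonempty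
    obtain ⟨a, ha⟩ := (hconn u hu).nonempty
    exact ⟨⟨a, Set.mem_biUnion hu ha⟩⟩

lemma minor_trans {W V : Type*} {H : SimpleGraph W} {G' G : SimpleGraph V}
    (hH : ∀ w, ∃ w', H.Adj w w') (hm : IsMinor H G') (g : V → Set V)
    (hconn : ∀ u, (∃ t, G'.Adj u t) → (G.induce (g u)).Connected)
    (hdisj : ∀ u w, (∃ t, G'.Adj u t) → (∃ t, G'.Adj w t) → u ≠ w → Disjoint (g u) (g w))
    (hadj : ∀ u w, G'.Adj u w → ∃ a ∈ g u, ∃ b ∈ g w, G.Adj a b) : IsMinor H G := by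
  obtain ⟨f, hne, hc, hd, ha⟩ := hm
  have iso : ∀ w, ∀ u ∈ f w, ∃ t, G'.Adj u t := by
    intro w u hu
    obtain ⟨w', hw'⟩ := hH w
    obtain ⟨a, haf, b, -, hab⟩ := ha w w' hw'
    obtain ⟨p⟩ := (hc w).preconnected ⟨u, hu⟩ ⟨a, haf⟩
    cases p with
    | nil => exact ⟨b, hab⟩
    | cons h p => exact ⟨_, h⟩
  have hcc : ∀ w, (G.induce (⋃ u ∈ f w, g u)).Connected := fun w =>
    conn_union (f w) g (hc w) (fun u hu => hconn u (iso w u hu)) hadj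
  refine ⟨fun w => ⋃ u ∈ f w, g u, ?_, hcc, ?_, ?_⟩
  · intro w
    obtain ⟨a⟩ := (hcc w).nonempty
    exact ⟨a.1, a.2⟩
  · intro w w' hww
    rw [Set.disjoint_left]
    intro a h1 h2
    obtain ⟨u, hu, hau⟩ := Set.mem_iUnion₂.1 h1
    obtain ⟨t, ht, hat⟩ := Set.mem_iUnion₂.1 h2
    have hut : u ≠ t := by
      rintro rfl
      exact Set.disjoint_left.1 (hd hww) hu ht
    exact Set.disjoint_left.1 (hdisj u t (iso w u hu) (iso w' t ht) hut) hau hat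
  · intro w w' hww
    obtain ⟨u, hu, t, ht, hut⟩ := ha w w' hww
    obtain ⟨a, ha, b, hb, hab⟩ := hadj u t hut
    exact ⟨a, Set.mem_biUnion hu ha, b, Set.mem_biUnion ht hb, hab⟩

lemma conn_singleton {V : Type*} (G : SimpleGraph V) (u : V) :
    (G.induce ({u} : Set V)).Connected := by
  rw [SimpleGraph.connected_iff]
  refine ⟨?_, ⟨⟨u, rfl⟩⟩⟩
  rintro ⟨a, rfl⟩ ⟨b, rfl⟩
  exact SimpleGraph.Reachable.refl _

/-- star-like sets are connected -/
lemma conn_star {V : Type*} (G : SimpleGraph V) (s : Set V) (u : V) (hu : u ∈ s)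
    (h : ∀ a ∈ s, a = u ∨ G.Adj u a) : (G.induce s).Connected := by
  rw [SimpleGraph.connected_iff]
  have key : ∀ a : s, (G.induce s).Reachable ⟨u, hu⟩ a := by
    rintro ⟨a, ha⟩
    rcases h a ha with rfl | h'
    · exact SimpleGraph.Reachable.refl _
    · exact SimpleGraph.Adj.reachable (by simpa using h')
  exact ⟨fun a b => (key a).symm.trans (key b), ⟨⟨u, hu⟩⟩⟩

lemma minor_mono {W V : Type*} {H : SimpleGraph W} {G' G : SimpleGraph V}
    (hH : ∀ w, ∃ w', H.Adj w w') (hle : G' ≤ G) (hm : IsMinor H G') : IsMinor H G := by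
  refine minor_trans hH hm (fun u => {u}) (fun u _ => conn_singleton G u) ?_ ?_
  · intro u w _ _ h
    simpa using h
  · intro u w h
    exact ⟨u, rfl, w, rfl, hle h⟩

lemma K5_iso : ∀ w : Fin 5, ∃ w', (⊤ : SimpleGraph (Fin 5)).Adj w w' := by
  intro w
  exact ⟨w + 1, by revert w; decide⟩

lemma K33_iso : ∀ w, ∃ w', (completeBipartiteGraph (Fin 3) (Fin 3)).Adj w w' := by
  rintro (w | w)
  · exact ⟨Sum.inr 0, by simp⟩
  · exact ⟨Sum.inl 0, by simp⟩

/-- number of edges -/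
noncomputable def ec {V : Type*} (G : SimpleGraph V) : ℕ := G.edgeSet.ncard
/-- degree -/
noncomputable def dg {V : Type*} (G : SimpleGraph V) (v : V) : ℕ := (G.neighborSet v).ncard

/-- delete a vertex (making it isolated) -/
def delV {V : Type*} (G : SimpleGraph V) (v : V) : SimpleGraph V where
  Adj a b := G.Adj a b ∧ a ≠ v ∧ b ≠ v
  symm := ⟨fun a b h => ⟨h.1.symm, h.2.2, h.2.1⟩⟩
  loopless := ⟨fun a h => G.loopless.irrefl a h.1⟩

/-- restrict to a set of vertices -/
def res {V : Type*} (G : SimpleGraph V) (s : Finset V) : SimpleGraph V where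
  Adj a b := G.Adj a b ∧ a ∈ s ∧ b ∈ s
  symm := ⟨fun a b h => ⟨h.1.symm, h.2.2, h.2.1⟩⟩
  loopless := ⟨fun a h => G.loopless.irrefl a h.1⟩

/-- merge y into x -/
def mrg {V : Type*} (G : SimpleGraph V) (x y : V) : SimpleGraph V where
  Adj a b := a ≠ b ∧ a ≠ y ∧ b ≠ y ∧ (G.Adj a b ∨ (a = x ∧ G.Adj y b) ∨ (b = x ∧ G.Adj y a))
  symm := ⟨fun a b h => ⟨h.1.symm, h.2.2.1, h.2.1, by
    rcases h.2.2.2 with h | h | h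
    · exact Or.inl h.symm
    · exact Or.inr (Or.inr h)
    · exact Or.inr (Or.inl h)⟩⟩
  loopless := ⟨fun a h => h.1 rfl⟩

variable {V : Type*} [Fintype V]

lemma ec_delEdge (G : SimpleGraph V) {u v : V} (h : G.Adj u v) :
    ec (G.deleteEdges {s(u, v)}) + 1 = ec G := by
  unfold ec
  rw [SimpleGraph.edgeSet_deleteEdges]
  exact Set.ncard_sdiff_singleton_add_one ((SimpleGraph.mem_edgeSet G).2 h) (Set.toFinite _)

lemma edgeSet_delV (G : SimpleGraph V) (v : V) :
    G.edgeSet = (delV G v).edgeSet ∪ (fun w => s(v, w)) '' (G.neighborSet v) := by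
  ext e
  induction e with
  | _ a b =>
    simp only [SimpleGraph.mem_edgeSet, Set.mem_union, delV, Set.mem_image,
      SimpleGraph.mem_neighborSet, Sym2.eq_iff]
    constructor
    · intro h
      by_cases ha : a = v
      · subst ha; exact Or.inr ⟨b, h, Or.inl ⟨rfl, rfl⟩⟩
      · by_cases hb : b = v
        · subst hb; exact Or.inr ⟨a, h.symm, Or.inr ⟨rfl, rfl⟩⟩
        · exact Or.inl ⟨h, ha, hb⟩
    · rintro (h | ⟨w, hw, ⟨rfl, rfl⟩ | ⟨rfl, rfl⟩⟩)
      · exact h.1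
      · exact hw
      · exact hw.symm

lemma star_inj (v : V) : Function.Injective (fun w => s(v, w)) := by
  intro a b h
  exact Sym2.congr_right.1 h

lemma ec_delV (G : SimpleGraph V) (v : V) : ec G ≤ ec (delV G v) + dg G v := by
  unfold ec dg
  conv_lhs => rw [edgeSet_delV G v]
  refine (Set.ncard_union_le _ _).trans ?_
  rw [Set.ncard_image_of_injective _ (star_inj v)]

lemma ec_mrg (G : SimpleGraph V) (x y : V) (hxy : x ≠ y) :
    ec G ≤ ec (mrg G x y) + (G.neighborSet y ∩ (G.neighborSet x ∪ {x})).ncard := by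
  have h1 := ec_delV G y
  have h2 : ec (delV G y) + (G.neighborSet y \ (G.neighborSet x ∪ {x})).ncard ≤ ec (mrg G x y) := by
    unfold ec
    rw [← Set.ncard_image_of_injective _ (star_inj x), ← Set.ncard_union_eq]
    · refine Set.ncard_le_ncard ?_ (Set.toFinite _)
      rintro e (he | ⟨w, hw, rfl⟩)
      · induction e with
        | _ a b => exact ⟨he.1.ne, he.2.1, he.2.2, Or.inl he.1⟩
      · simp only [Set.mem_sdiff, Set.mem_union, not_or, SimpleGraph.mem_neighborSet,
          Set.mem_singleton_iff] at hw
        exact ⟨fun h => hw.2.2 h.symm, hxy, hw.1.ne', Or.inr (Or.inl ⟨rfl, hw.1⟩)⟩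
    · rw [Set.disjoint_left]
      rintro e he ⟨w, hw, rfl⟩
      simp only [Set.mem_sdiff, Set.mem_union, not_or, SimpleGraph.mem_neighborSet,
          Set.mem_singleton_iff] at hw
      exact hw.2.1 he.1
  have h3 := Set.ncard_inter_add_ncard_sdiff_eq_ncard (G.neighborSet y) (G.neighborSet x ∪ {x})
  unfold dg at h1
  omega

lemma sum_dg (G : SimpleGraph V) (S : Finset V) (hS : ∀ u v, G.Adj u v → u ∈ S) :
    ∑ v ∈ S, dg G v = 2 * ec G := by
  classical
  have h := G.sum_degrees_eq_twice_card_edges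
  have e1 : ec G = G.edgeFinset.card := by
    unfold ec; rw [Set.ncard_eq_toFinset_card', SimpleGraph.edgeFinset]
  have e2 : ∀ v, dg G v = G.degree v := by
    intro v
    unfold dg; rw [Set.ncard_eq_toFinset_card', ← SimpleGraph.card_neighborFinset_eq_degree,
      SimpleGraph.neighborFinset]
  rw [e1, ← h]
  simp only [e2]
  apply Finset.sum_subset (Finset.subset_univ _)
  intro v _ hv
  by_contra h0
  obtain ⟨w, hw⟩ := (G.degree_pos_iff_exists_adj v).1 (Nat.pos_of_ne_zero h0)
  exact hv (hS v w hw)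

lemma exists_low (G : SimpleGraph V) (S : Finset V) (hS : ∀ u v, G.Adj u v → u ∈ S) (k : ℕ)
    (h : 2 * ec G < k * S.card) : ∃ v ∈ S, dg G v < k := by
  rw [← sum_dg G S hS] at h
  by_contra! hc
  have := Finset.card_nsmul_le_sum S (dg G) k hc
  simp only [smul_eq_mul] at this
  rw [mul_comm] at this
  exact absurd h (not_lt.2 this)

lemma exists_adj_of_ec (G : SimpleGraph V) (h : 0 < ec G) : ∃ u v, G.Adj u v := by
  unfold ec at h
  obtain ⟨e, he⟩ := (Set.ncard_pos (Set.toFinite _)).1 h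
  induction e with
  | _ a b => exact ⟨a, b, he⟩

/-- separations with a cherry in the cut -/
lemma ec_sep (G : SimpleGraph V) (S T : Finset V)
    (h : ∀ u v, G.Adj u v → (u ∈ S ∧ v ∈ S) ∨ (u ∈ T ∧ v ∈ T)) (x y p : V) (hxy : x ≠ y)
    (hpx : G.Adj p x) (hpy : G.Adj p y)
    (hx : x ∈ S ∧ x ∈ T) (hy : y ∈ S ∧ y ∈ T) (hp : p ∈ S ∧ p ∈ T) :
    ec G + 2 ≤ ec (res G S) + ec (res G T) := by
  unfold ec
  rw [← Set.ncard_union_add_ncard_inter _ _ (Set.toFinite _) (Set.toFinite _)]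
  apply add_le_add
  · refine Set.ncard_le_ncard ?_ (Set.toFinite _)
    intro e he
    induction e with
    | _ a b =>
      rcases h a b he with h' | h'
      · exact Or.inl ⟨he, h'⟩
      · exact Or.inr ⟨he, h'⟩
  · have : ({s(p, x), s(p, y)} : Set (Sym2 V)).ncard = 2 := by
      rw [Set.ncard_pair]
      intro h; exact hxy (star_inj p h)
    rw [← this]
    refine Set.ncard_le_ncard ?_ (Set.toFinite _)
    rintro e (rfl | rfl)
    · exact ⟨⟨hpx, hp.1, hx.1⟩, ⟨hpx, hp.2, hx.2⟩⟩
    · exact ⟨⟨hpy, hp.1, hy.1⟩, ⟨hpy, hp.2, hy.2⟩⟩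

lemma minor_mrg {W : Type*} {H : SimpleGraph W} {G0 G : SimpleGraph V}
    (hH : ∀ w, ∃ w', H.Adj w w') (hle : G0 ≤ G) (x y : V) (X : Set V) (hx : x ∈ X) (hy : y ∈ X)
    (hX : (G.induce X).Connected)
    (hiso : ∀ u t, (mrg G0 x y).Adj u t → u ≠ x → u ∉ X)
    (hm : IsMinor H (mrg G0 x y)) : IsMinor H G := by
  classical
  refine minor_trans hH hm (fun u => if u = x then X else {u}) ?_ ?_ ?_
  · intro u _
    by_cases h : u = x
    · have e : (if u = x then X else {u} : Set V) = X := if_pos h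
      rw [e]; exact hX
    · have e : (if u = x then X else {u} : Set V) = {u} := if_neg h
      rw [e]; exact conn_singleton G u
  · rintro u w ⟨t, ht⟩ ⟨t', ht'⟩ huw
    split_ifs with h1 h2 h2
    · exact absurd (h1.trans h2.symm) huw
    · simpa using hiso w t' ht' h2
    · simpa using hiso u t ht h1
    · simpa using huw
  · intro u w h
    have hux : u ∈ (if u = x then X else {u} : Set V) := by
      split_ifs with h
      · rwa [h]
      · rfl
    have hwx : w ∈ (if w = x then X else {w} : Set V) := by
      split_ifs with h
      · rwa [h]
      · rfl
    rcases h.2.2.2 with h' | ⟨rfl, h'⟩ | ⟨rfl, h'⟩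
    · exact ⟨u, hux, w, hwx, hle h'⟩
    · exact ⟨y, by simpa using hy, w, hwx, hle h'⟩
    · exact ⟨u, hux, y, by simpa using hy, hle h'.symm⟩

lemma K5_of (G : SimpleGraph V) (v a c e : V) (T : Set V) (hT : (G.induce T).Connected)
    (h1 : G.Adj v a) (h2 : G.Adj v c) (h3 : G.Adj v e) (h4 : G.Adj a c) (h5 : G.Adj a e)
    (h6 : G.Adj c e) (n1 : v ∉ T) (n2 : a ∉ T) (n3 : c ∉ T) (n4 : e ∉ T)
    (m1 : ∃ t ∈ T, G.Adj v t) (m2 : ∃ t ∈ T, G.Adj a t) (m3 : ∃ t ∈ T, G.Adj c t)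
    (m4 : ∃ t ∈ T, G.Adj e t) : IsMinor (⊤ : SimpleGraph (Fin 5)) G := by
  have m1' : ∃ t ∈ T, G.Adj t v := by simpa only [G.adj_comm] using m1
  have m2' : ∃ t ∈ T, G.Adj t a := by simpa only [G.adj_comm] using m2
  have m3' : ∃ t ∈ T, G.Adj t c := by simpa only [G.adj_comm] using m3
  have m4' : ∃ t ∈ T, G.Adj t e := by simpa only [G.adj_comm] using m4
  have hTne : T.Nonempty := by
    obtain ⟨t, ht, _⟩ := m1
    exact ⟨t, ht⟩
  refine ⟨![{v}, {a}, {c}, {e}, T], ?_, ?_, ?_, ?_⟩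
  · intro w; fin_cases w <;> simp [hTne]
  · intro w; fin_cases w
    · exact conn_singleton G v
    · exact conn_singleton G a
    · exact conn_singleton G c
    · exact conn_singleton G e
    · exact hT
  · intro w w' h
    fin_cases w <;> fin_cases w' <;>
      simp [h1.ne, h2.ne, h3.ne, h4.ne, h5.ne, h6.ne, h1.ne', h2.ne', h3.ne', h4.ne', h5.ne',
        h6.ne', n1, n2, n3, n4] at h ⊢
  · intro w w' h
    fin_cases w <;> fin_cases w' <;>
      simp [h1, h2, h3, h4, h5, h6, h1.symm, h2.symm, h3.symm, h4.symm, h5.symm, h6.symm,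
        m1, m2, m3, m4, m1', m2', m3', m4'] at h ⊢

lemma K5_case (G : SimpleGraph V) (v a b c d e : V) (hb : G.Adj v b) (ha : G.Adj v a)
    (hc : G.Adj v c) (hd : G.Adj v d) (he : G.Adj v e) (hab : a ≠ b) (hcd : c ≠ d)
    (ac : G.Adj a c) (ae : G.Adj a e) (ce : G.Adj c e) (bd : G.Adj b d) (ad : G.Adj a d)
    (cb : G.Adj c b) (eb : G.Adj e b) (hed : e ≠ d) : IsMinor (⊤ : SimpleGraph (Fin 5)) G := by
  refine K5_of G v a c e {b, d} (conn_star G _ b (by simp) ?_) ha hc he ac ae ce ?_ ?_ ?_ ?_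
    ⟨b, by simp, hb⟩ ⟨d, by simp, ad⟩ ⟨b, by simp, cb⟩ ⟨b, by simp, eb⟩
  · rintro t (rfl | rfl)
    · exact Or.inl rfl
    · exact Or.inr bd
  · simp [hb.ne, hd.ne]
  · simp [hab, ad.ne]
  · simp [cb.ne, hcd]
  · simp [eb.ne, hed]

lemma K5_nbhd (G : SimpleGraph V) (v : V) (N : Finset V) (hN : ∀ u, u ∈ N ↔ G.Adj v u)
    (hlo : 4 ≤ N.card) (hhi : N.card ≤ 5)
    (h : ∀ x ∈ N, 4 ≤ ((N : Set V) ∩ (G.neighborSet x ∪ {x})).ncard) :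
    IsMinor (⊤ : SimpleGraph (Fin 5)) G := by
  classical
  have key : ∀ x ∈ N, ∀ y ∈ N, ∀ z ∈ N, x ≠ y → x ≠ z → ¬ G.Adj x y → ¬ G.Adj x z → y = z := by
    intro x hx y hy z hz hxy hxz nxy nxz
    by_contra hyz
    have h1 := h x hx
    have h2 := Set.ncard_inter_add_ncard_sdiff_eq_ncard (N : Set V) (G.neighborSet x ∪ {x})
    have h3 : ({y, z} : Set V).ncard ≤ ((N : Set V) \ (G.neighborSet x ∪ {x})).ncard := by
      refine Set.ncard_le_ncard ?_ (Set.toFinite _)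
      rintro t (rfl | rfl)
      · exact ⟨hy, by simp [nxy, hxy.symm]⟩
      · exact ⟨hz, by simp [nxz, hxz.symm]⟩
    rw [Set.ncard_pair hyz] at h3
    rw [Set.ncard_coe_finset] at h2
    omega
  by_cases hcl : ∀ x ∈ N, ∀ y ∈ N, x ≠ y → G.Adj x y
  · obtain ⟨a, ha⟩ : N.Nonempty := Finset.card_pos.1 (by omega)
    have h3 : 2 < (N.erase a).card := by rw [Finset.card_erase_of_mem ha]; omega
    obtain ⟨c, d, e, hc, hd, he, cd, ce, de⟩ := Finset.two_lt_card_iff.1 h3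
    rw [Finset.mem_erase] at hc hd he
    refine K5_of G v a c e {d} (conn_singleton G d) ((hN _).1 ha) ((hN _).1 hc.2) ((hN _).1 he.2)
      (hcl _ ha _ hc.2 hc.1.symm) (hcl _ ha _ he.2 he.1.symm) (hcl _ hc.2 _ he.2 ce)
      ((hN _).1 hd.2).ne hd.1.symm cd de.symm ⟨d, rfl, (hN _).1 hd.2⟩
      ⟨d, rfl, hcl _ ha _ hd.2 hd.1.symm⟩ ⟨d, rfl, hcl _ hc.2 _ hd.2 cd⟩
      ⟨d, rfl, hcl _ he.2 _ hd.2 de.symm⟩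
  · push Not at hcl
    obtain ⟨a, ha, b, hb, hab, nab⟩ := hcl
    have nba : ¬ G.Adj b a := fun h => nab h.symm
    have h5 : N.card = 5 := by
      by_contra h5
      have h1 := h a ha
      have h2 := Set.ncard_inter_add_ncard_sdiff_eq_ncard (N : Set V) (G.neighborSet a ∪ {a})
      have h3 : ({b} : Set V).ncard ≤ ((N : Set V) \ (G.neighborSet a ∪ {a})).ncard := by
        refine Set.ncard_le_ncard ?_ (Set.toFinite _)
        rintro t rfl
        exact ⟨hb, by simp [nab, hab.symm]⟩
      rw [Set.ncard_singleton] at h3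
      rw [Set.ncard_coe_finset] at h2
      omega
    have h3 : 2 < ((N.erase a).erase b).card := by
      rw [Finset.card_erase_of_mem (by simp [hab.symm, hb]), Finset.card_erase_of_mem ha]; omega
    obtain ⟨c, d, e, hc, hd, he, cd, ce, de⟩ := Finset.two_lt_card_iff.1 h3
    simp only [Finset.mem_erase] at hc hd he
    have toA : ∀ t, t ≠ b ∧ t ≠ a ∧ t ∈ N → G.Adj a t := by
      intro t ht
      by_contra hn
      exact ht.1 (key a ha t ht.2.2 b hb ht.2.1.symm hab hn nab)
    have toB : ∀ t, t ≠ b ∧ t ≠ a ∧ t ∈ N → G.Adj b t := by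
      intro t ht
      by_contra hn
      exact ht.2.1 (key b hb t ht.2.2 a ha ht.1.symm hab.symm hn nba)
    have main : ∀ c d e, c ≠ b ∧ c ≠ a ∧ c ∈ N → d ≠ b ∧ d ≠ a ∧ d ∈ N → e ≠ b ∧ e ≠ a ∧ e ∈ N →
        c ≠ d → c ≠ e → d ≠ e → ¬ G.Adj c d → IsMinor (⊤ : SimpleGraph (Fin 5)) G := by
      intro c d e hc hd he cd ce de ncd
      have hce : G.Adj c e := by
        by_contra hn
        exact de (key c hc.2.2 d hd.2.2 e he.2.2 cd ce ncd hn)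
      exact K5_case G v a b c d e ((hN _).1 hb) ((hN _).1 ha) ((hN _).1 hc.2.2) ((hN _).1 hd.2.2)
        ((hN _).1 he.2.2) hab cd (toA c hc) (toA e he) hce (toB d hd) (toA d hd) (toB c hc).symm
        (toB e he).symm de.symm
    by_cases q1 : G.Adj c d
    · by_cases q2 : G.Adj c e
      · by_cases q3 : G.Adj d e
        · exact K5_of G v a c e {d} (conn_singleton G d) ((hN _).1 ha) ((hN _).1 hc.2.2)
            ((hN _).1 he.2.2) (toA c hc) (toA e he) q2
            ((hN _).1 hd.2.2).ne hd.2.1.symm cd de.symm ⟨d, rfl, (hN _).1 hd.2.2⟩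
            ⟨d, rfl, toA d hd⟩ ⟨d, rfl, q1⟩ ⟨d, rfl, q3.symm⟩
        · exact main d e c hd he hc de cd.symm ce.symm q3
      · exact main c e d hc he hd ce cd de.symm q2
    · exact main c d e hc hd he cd ce de q1

lemma shrink (G : SimpleGraph V) (k : ℕ) (h : k ≤ ec G) : ∃ G' ≤ G, ec G' = k := by
  obtain ⟨m, hm⟩ := Nat.exists_eq_add_of_le h
  induction m generalizing G with
  | zero => exact ⟨G, le_rfl, by omega⟩
  | succ m ih =>
    obtain ⟨p, q, hpq⟩ := exists_adj_of_ec G (by omega)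
    have hdel := ec_delEdge G hpq
    obtain ⟨G', h1, h2⟩ := ih (G.deleteEdges {s(p, q)}) (by omega) (by omega)
    exact ⟨G', h1.trans (SimpleGraph.deleteEdges_le _), h2⟩

theorem mader (n : ℕ) : ∀ (G : SimpleGraph V) (S : Finset V), S.card ≤ n →
    S.Nonempty → (∀ u v, G.Adj u v → u ∈ S) → ¬ IsMinor (⊤ : SimpleGraph (Fin 5)) G →
    ec G + 3 ≤ 3 * S.card := by
  classical
  induction n with
  | zero =>
    intro G S h hne
    have := Finset.card_pos.2 hne
    omega
  | succ n ih =>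
    intro G₀ S hn hne hS₀ hK₀
    by_contra hlt
    have hS0 := Finset.card_pos.2 hne
    obtain ⟨G, hGle, hGe⟩ := shrink G₀ (3 * S.card - 2) (by omega)
    have hS : ∀ u v, G.Adj u v → u ∈ S := fun u v h => hS₀ u v (hGle h)
    have hK : ¬ IsMinor (⊤ : SimpleGraph (Fin 5)) G := fun h => hK₀ (minor_mono K5_iso hGle h)
    have heq : ec G + 2 = 3 * S.card := by omega
    obtain ⟨p, q, hpq⟩ := exists_adj_of_ec G (by omega)
    have hcard : 2 ≤ S.card := by
      have : 1 < S.card := Finset.one_lt_card.2 ⟨p, hS _ _ hpq, q, hS _ _ hpq.symm, hpq.ne⟩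
      omega
    obtain ⟨v, hv, hd⟩ := exists_low G S hS 6 (by omega)
    have hers : (S.erase v).card + 1 = S.card := Finset.card_erase_add_one hv
    have herne : (S.erase v).Nonempty := Finset.card_pos.1 (by omega)
    have hd4 : 4 ≤ dg G v := by
      by_contra h4
      have h1 := ec_delV G v
      have hle : delV G v ≤ G := fun a b h => h.1
      have := ih (delV G v) (S.erase v) (by omega) herne
        (fun a b h => Finset.mem_erase.2 ⟨h.2.1, hS _ _ h.1⟩)
        (fun h => hK (minor_mono K5_iso hle h))
      omega
    have hNc : (G.neighborFinset v).card = dg G v := by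
      unfold dg; rw [Set.ncard_eq_toFinset_card', SimpleGraph.neighborFinset]
    refine hK (K5_nbhd G v (G.neighborFinset v) (by simp) (by omega) (by omega) ?_)
    intro x hx
    rw [SimpleGraph.mem_neighborFinset] at hx
    rw [SimpleGraph.coe_neighborFinset]
    by_contra h4
    have h1 := ec_mrg G x v hx.ne'
    have hmS : ∀ a b, (mrg G x v).Adj a b → a ∈ S.erase v := by
      intro a b h
      refine Finset.mem_erase.2 ⟨h.2.1, ?_⟩
      rcases h.2.2.2 with h' | ⟨rfl, h'⟩ | ⟨rfl, h'⟩
      · exact hS _ _ h'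
      · exact hS _ _ hx.symm
      · exact hS _ _ h'.symm
    have hsub : ∀ a b, (mrg G x v).Adj a b → a ≠ x → a ∉ ({x, v} : Set V) := by
      intro a b h hax
      simp [hax, h.2.1]
    have hnm : ¬ IsMinor (⊤ : SimpleGraph (Fin 5)) (mrg G x v) := fun h => hK
      (minor_mrg K5_iso le_rfl x v {x, v} (by simp) (by simp)
        (conn_star G _ x (by simp) (by
          rintro t (rfl | rfl)
          · exact Or.inl rfl
          · exact Or.inr hx.symm)) hsub h)
    have := ih (mrg G x v) (S.erase v) (by omega) herne hmS hnm
    omega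

lemma K33_of (G : SimpleGraph V) (x y v p q : V) (C : Set V) (hC : (G.induce C).Connected)
    (xy : x ≠ y) (vp : v ≠ p) (vq : v ≠ q) (pq : p ≠ q)
    (xv : G.Adj x v) (xp : G.Adj x p) (xq : G.Adj x q)
    (yv : G.Adj y v) (yp : G.Adj y p) (yq : G.Adj y q)
    (cv : ∃ t ∈ C, G.Adj t v) (cp : ∃ t ∈ C, G.Adj t p) (cq : ∃ t ∈ C, G.Adj t q)
    (nx : x ∉ C) (ny : y ∉ C) (nv : v ∉ C) (np : p ∉ C) (nq : q ∉ C) :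
    IsMinor (completeBipartiteGraph (Fin 3) (Fin 3)) G := by
  have cv' : ∃ t ∈ C, G.Adj v t := by simpa only [G.adj_comm] using cv
  have cp' : ∃ t ∈ C, G.Adj p t := by simpa only [G.adj_comm] using cp
  have cq' : ∃ t ∈ C, G.Adj q t := by simpa only [G.adj_comm] using cq
  have hne : C.Nonempty := by
    obtain ⟨t, ht, _⟩ := cv
    exact ⟨t, ht⟩
  refine ⟨Sum.elim ![{x}, {y}, C] ![{v}, {p}, {q}], ?_, ?_, ?_, ?_⟩
  · rintro (w | w) <;> fin_cases w <;> simp [hne]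
  · rintro (w | w) <;> fin_cases w
    · exact conn_singleton G x
    · exact conn_singleton G y
    · exact hC
    · exact conn_singleton G v
    · exact conn_singleton G p
    · exact conn_singleton G q
  · rintro (w | w) (w' | w') h <;> fin_cases w <;> fin_cases w' <;>
      simp [xy, xy.symm, vp, vp.symm, vq, vq.symm, pq, pq.symm, xv.ne, xp.ne, xq.ne, yv.ne, yp.ne,
        yq.ne, xv.ne', xp.ne', xq.ne', yv.ne', yp.ne', yq.ne', nx, ny, nv, np, nq] at h ⊢
  · rintro (w | w) (w' | w') h <;> fin_cases w <;> fin_cases w' <;>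
      simp [xv, xp, xq, yv, yp, yq, xv.symm, xp.symm, xq.symm, yv.symm, yp.symm, yq.symm,
        cv, cp, cq, cv', cp', cq'] at h ⊢

lemma conn_mono {G' G : SimpleGraph V} (hle : G' ≤ G) (C : Set V)
    (h : (G'.induce C).Connected) : (G.induce C).Connected :=
  h.mono (fun a b hab => hle hab)

/-- the key reduction: K33, or a separation -/
lemma sep_case (G : SimpleGraph V) (S : Finset V) (hS : ∀ u v, G.Adj u v → u ∈ S)
    (x y z v p q : V) (C : Set V) (hCS : ∀ u ∈ C, u ∈ S) (zC : z ∈ C)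
    (hCn : ∀ u ∈ C, ∀ w, G.Adj u w → w ∈ C ∨ w = x ∨ w = y ∨ w = v ∨ w = p ∨ w = q)
    (nx : x ∉ C) (ny : y ∉ C) (nv : v ∉ C) (np : p ∉ C) (nq : q ∉ C)
    (xy : x ≠ y) (vp : v ≠ p) (vq : v ≠ q) (pq : p ≠ q)
    (hv : ∀ w, G.Adj v w → w = x ∨ w = y ∨ w = z) (vx : G.Adj v x) (vy : G.Adj v y)
    (xp : G.Adj x p) (xq : G.Adj x q) (yp : G.Adj y p) (yq : G.Adj y q)
    (hq : ∀ u ∈ C, ¬ G.Adj u q)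
    (ih : ∀ T : Finset V, T.card < S.card → 3 ≤ T.card → ec (res G T) + 4 ≤ 2 * T.card) :
    ec G + 4 ≤ 2 * S.card := by
  classical
  let V1 : Finset V := S.filter (fun u => u ∈ C ∨ u = v ∨ u = x ∨ u = y ∨ u = p)
  let V2 : Finset V := S.filter (fun u => ¬ (u ∈ C ∨ u = v))
  have hvS := hS _ _ vx
  have hxS := hS _ _ xp
  have hyS := hS _ _ yp
  have hpS := hS _ _ xp.symm
  have hqS := hS _ _ xq.symm
  have hun : V1 ∪ V2 = S := by
    ext u
    simp only [V1, V2, Finset.mem_union, Finset.mem_filter]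
    tauto
  have hin : V1 ∩ V2 = {x, y, p} := by
    ext u
    simp only [V1, V2, Finset.mem_inter, Finset.mem_filter, Finset.mem_insert,
      Finset.mem_singleton]
    constructor
    · tauto
    · rintro (rfl | rfl | rfl)
      · exact ⟨⟨hxS, by tauto⟩, hxS, by rintro (h | h); exacts [nx h, vx.ne h.symm]⟩
      · exact ⟨⟨hyS, by tauto⟩, hyS, by rintro (h | h); exacts [ny h, vy.ne h.symm]⟩
      · exact ⟨⟨hpS, by tauto⟩, hpS, by rintro (h | h); exacts [np h, vp h.symm]⟩
  have hc3 : ({x, y, p} : Finset V).card = 3 := Finset.card_eq_three.2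
    ⟨x, y, p, xy, xp.ne, yp.ne, rfl⟩
  have hcard := Finset.card_union_add_card_inter V1 V2
  rw [hun, hin, hc3] at hcard
  have hm : ∀ t ∈ ({x, y, p} : Finset V), t ∈ V1 ∧ t ∈ V2 := by
    intro t ht
    rw [← hin, Finset.mem_inter] at ht
    exact ht
  have h31 : 3 ≤ V1.card := by
    rw [← hc3]; exact Finset.card_le_card (fun t ht => (hm t ht).1)
  have h32 : 3 ≤ V2.card := by
    rw [← hc3]; exact Finset.card_le_card (fun t ht => (hm t ht).2)
  have l1 : V1.card < S.card := by
    apply Finset.card_lt_card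
    refine ⟨Finset.filter_subset _ _, fun h => ?_⟩
    have := (Finset.mem_filter.1 (h hqS)).2
    rcases this with h | h | h | h | h
    exacts [nq h, vq h.symm, xq.ne h.symm, yq.ne h.symm, pq h.symm]
  have l2 : V2.card < S.card := by
    apply Finset.card_lt_card
    refine ⟨Finset.filter_subset _ _, fun h => ?_⟩
    exact (Finset.mem_filter.1 (h hvS)).2 (Or.inr rfl)
  have i1 := ih V1 l1 h31
  have i2 := ih V2 l2 h32
  have half : ∀ u w, G.Adj u w → (u ∈ C ∨ u = v) → u ∈ V1 ∧ w ∈ V1 := by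
    intro u w h hu
    have hw := hS _ _ h.symm
    have huS := hS _ _ h
    refine ⟨Finset.mem_filter.2 ⟨huS, by tauto⟩, Finset.mem_filter.2 ⟨hw, ?_⟩⟩
    rcases hu with hu | rfl
    · rcases hCn u hu w h with h' | h' | h' | h' | h' | h'
      · tauto
      · tauto
      · tauto
      · tauto
      · tauto
      · subst h'; exact absurd h (hq u hu)
    · rcases hv w h with h' | h' | rfl
      · tauto
      · tauto
      · exact Or.inl zC
  have := ec_sep G V1 V2 (by
    intro u w h
    by_cases hu : u ∈ C ∨ u = v
    · exact Or.inl (half u w h hu)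
    · by_cases hw : w ∈ C ∨ w = v
      · exact Or.inl (half w u h.symm hw).symm
      · exact Or.inr ⟨Finset.mem_filter.2 ⟨hS _ _ h, hu⟩,
          Finset.mem_filter.2 ⟨hS _ _ h.symm, hw⟩⟩) x y p xy xp.symm yp.symm
    (hm x (by simp)) (hm y (by simp)) (hm p (by simp))
  omega

lemma bip_base (G : SimpleGraph V) (S : Finset V) (c : V → Bool) (hS : ∀ u v, G.Adj u v → u ∈ S)
    (hc : ∀ u v, G.Adj u v → c u ≠ c v) (h3 : S.card = 3) : ec G ≤ 2 := by
  classical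
  have main : ∀ x y z, S = {x, y, z} → c x = c y → ec G ≤ 2 := by
    intro x y z h hxy
    have : G.edgeSet ⊆ {s(z, x), s(z, y)} := by
      intro e he
      induction e with
      | _ a b =>
        have hab : G.Adj a b := he
        have h1 := hS _ _ hab
        have h2 := hS _ _ hab.symm
        have h3 := hc _ _ hab
        rw [h] at h1 h2
        simp only [Finset.mem_insert, Finset.mem_singleton] at h1 h2
        rcases h1 with rfl | rfl | rfl <;> rcases h2 with rfl | rfl | rfl <;>
          simp_all [Sym2.eq_swap]
    exact (Set.ncard_le_ncard this (Set.toFinite _)).trans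
      ((Set.ncard_insert_le _ _).trans (by simp))
  obtain ⟨x, y, z, -, -, -, h⟩ := Finset.card_eq_three.1 h3
  by_cases h1 : c x = c y
  · exact main x y z h h1
  · by_cases h2 : c x = c z
    · exact main x z y (by rw [h]; ext; simp; tauto) h2
    · exact main y z x (by rw [h]; ext; simp; tauto) (by
        revert h1 h2; cases c x <;> cases c y <;> cases c z <;> simp)

theorem bip (c : V → Bool) (n : ℕ) : ∀ (G : SimpleGraph V) (S : Finset V), S.card ≤ n →
    3 ≤ S.card → (∀ u v, G.Adj u v → u ∈ S) → (∀ u v, G.Adj u v → c u ≠ c v) →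
    ¬ IsMinor (completeBipartiteGraph (Fin 3) (Fin 3)) G →
    ec G + 4 ≤ 2 * S.card := by
  classical
  induction n with
  | zero =>
    intro G S h hne
    omega
  | succ n ih =>
    intro G₀ S hn hne hS₀ hc₀ hK₀
    by_contra hlt
    obtain ⟨G, hGle, hGe⟩ := shrink G₀ (2 * S.card - 3) (by omega)
    have hS : ∀ u v, G.Adj u v → u ∈ S := fun u v h => hS₀ u v (hGle h)
    have hc : ∀ u v, G.Adj u v → c u ≠ c v := fun u v h => hc₀ u v (hGle h)
    have hK : ¬ IsMinor (completeBipartiteGraph (Fin 3) (Fin 3)) G :=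
      fun h => hK₀ (minor_mono K33_iso hGle h)
    have heq : ec G + 3 = 2 * S.card := by omega
    by_cases h3 : S.card = 3
    · have := bip_base G S c hS hc h3
      omega
    have hdle : ∀ v, delV G v ≤ G := fun v a b h => h.1
    have hmin : ∀ v ∈ S, 3 ≤ dg G v := by
      intro v hv
      by_contra h4
      have h1 := ec_delV G v
      have hers : (S.erase v).card + 1 = S.card := Finset.card_erase_add_one hv
      have := ih (delV G v) (S.erase v) (by omega) (by omega)
        (fun a b h => Finset.mem_erase.2 ⟨h.2.1, hS _ _ h.1⟩)
        (fun a b h => hc a b h.1)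
        (fun h => hK (minor_mono K33_iso (hdle v) h))
      omega
    obtain ⟨v, hv, hd⟩ := exists_low G S hS 4 (by omega)
    have hd3 : dg G v = 3 := by have := hmin v hv; omega
    obtain ⟨x, y, z, xy, xz, yz, hN⟩ := Set.ncard_eq_three.1 hd3
    have hN' : ∀ w, G.Adj v w ↔ w = x ∨ w = y ∨ w = z := by
      intro w
      rw [← SimpleGraph.mem_neighborSet, hN]; simp
    have vx : G.Adj v x := (hN' x).2 (by simp)
    have vy : G.Adj v y := (hN' y).2 (by simp)
    have vz : G.Adj v z := (hN' z).2 (by simp)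
    have hxS := hS _ _ vx.symm
    have hyS := hS _ _ vy.symm
    have cxy : c x = c y := by
      have h1 := hc _ _ vx; have h2 := hc _ _ vy
      revert h1 h2; cases c x <;> cases c y <;> cases c v <;> simp
    have cxz : c x = c z := by
      have h1 := hc _ _ vx; have h2 := hc _ _ vz
      revert h1 h2; cases c x <;> cases c z <;> cases c v <;> simp
    have h5 : 5 ≤ S.card := by
      have hx := hmin x hxS
      have hd : Disjoint (G.neighborSet x) {x, y} := by
        rw [Set.disjoint_left]
        rintro t ht (rfl | rfl)
        · exact G.loopless.irrefl _ ht
        · exact hc _ _ ht cxy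
      have h1 := Set.ncard_union_eq hd (Set.toFinite _) (Set.toFinite _)
      rw [Set.ncard_pair xy] at h1
      have h2 : (G.neighborSet x ∪ {x, y}).ncard ≤ (S : Set V).ncard := by
        refine Set.ncard_le_ncard ?_ (Set.toFinite _)
        rintro t (ht | rfl | rfl)
        · exact hS _ _ (SimpleGraph.Adj.symm ht)
        · exact hxS
        · exact hyS
      rw [Set.ncard_coe_finset] at h2
      unfold dg at hx
      omega
    -- merge
    have hk : 2 ≤ ((delV G v).neighborSet y ∩ ((delV G v).neighborSet x ∪ {x})).ncard := by
      by_contra hk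
      have e1 := ec_delV G v
      have e2 := ec_mrg (delV G v) x y xy
      have c1 : (S.erase v).card + 1 = S.card := Finset.card_erase_add_one hv
      have c2 : ((S.erase v).erase y).card + 1 = (S.erase v).card :=
        Finset.card_erase_add_one (Finset.mem_erase.2 ⟨vy.ne', hyS⟩)
      have hsub : ∀ a b, (mrg (delV G v) x y).Adj a b → a ≠ v ∧ a ≠ y ∧ a ∈ S := by
        intro a b h
        rcases h.2.2.2 with h' | ⟨rfl, h'⟩ | ⟨rfl, h'⟩
        · exact ⟨h'.2.1, h.2.1, hS _ _ h'.1⟩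
        · exact ⟨vx.ne', h.2.1, hxS⟩
        · exact ⟨h'.2.2, h.2.1, hS _ _ h'.1.symm⟩
      have := ih (mrg (delV G v) x y) ((S.erase v).erase y) (by omega) (by omega)
        (fun a b h => by
          have := hsub a b h
          simp only [Finset.mem_erase]; tauto)
        (fun a b h => by
          rcases h.2.2.2 with h' | ⟨rfl, h'⟩ | ⟨rfl, h'⟩
          · exact hc _ _ h'.1
          · rw [cxy]; exact hc _ _ h'.1
          · rw [cxy]; exact (hc _ _ h'.1).symm)
        (fun h => hK (minor_mrg K33_iso (hdle v) x y {v, x, y} (by simp) (by simp)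
          (conn_star G _ v (by simp) (by
            rintro t (rfl | rfl | rfl)
            · exact Or.inl rfl
            · exact Or.inr vx
            · exact Or.inr vy))
          (fun a b h hax => by
            have := hsub a b h
            simp [this.1, hax, this.2.1]) h))
      omega
    obtain ⟨p, q, hp, hq, pq⟩ := (Set.one_lt_ncard_iff (Set.toFinite _)).1 hk
    have conv : ∀ t, t ∈ (delV G v).neighborSet y ∩ ((delV G v).neighborSet x ∪ {x}) →
        v ≠ t ∧ G.Adj x t ∧ G.Adj y t := by
      rintro t ⟨h1, h2 | rfl⟩
      · exact ⟨h1.2.2.symm, h2.1, h1.1⟩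
      · exact absurd cxy.symm (hc _ _ h1.1)
    obtain ⟨vp, xp, yp⟩ := conv p hp
    obtain ⟨vq, xq, yq⟩ := conv q hq
    have zp : z ≠ p := by
      rintro rfl; exact hc _ _ xp cxz
    have zq : z ≠ q := by
      rintro rfl; exact hc _ _ xq cxz
    let F : Finset V := Finset.univ.filter (fun u => ¬ (u = x ∨ u = y ∨ u = v ∨ u = p ∨ u = q))
    let G' := res G F
    let C : Set V := (G'.connectedComponentMk z).supp
    have zC : z ∈ C := rfl
    have hle : G' ≤ G := fun a b h => h.1
    have hconn : (G.induce C).Connected :=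
      conn_mono hle C (SimpleGraph.ConnectedComponent.connected_toSimpleGraph _)
    have hCF : ∀ u ∈ C, u ∈ F := by
      intro u hu
      have hr : G'.Reachable u z := SimpleGraph.ConnectedComponent.exact hu
      obtain ⟨w⟩ := hr
      cases w with
      | nil =>
        refine Finset.mem_filter.2 ⟨Finset.mem_univ _, ?_⟩
        rintro (h | h | h | h | h)
        exacts [xz h.symm, yz h.symm, vz.ne h.symm, zp h, zq h]
      | cons h _ => exact h.2.1
    have hCS : ∀ u ∈ C, u ∈ S := by
      intro u hu
      have hr : G'.Reachable u z := SimpleGraph.ConnectedComponent.exact hu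
      obtain ⟨w⟩ := hr
      cases w with
      | nil => exact hS _ _ vz.symm
      | cons h _ => exact hS _ _ h.1
    have hCF' : ∀ u ∈ C, ¬ (u = x ∨ u = y ∨ u = v ∨ u = p ∨ u = q) := fun u hu =>
      (Finset.mem_filter.1 (hCF u hu)).2
    have nx : x ∉ C := fun h => hCF' x h (by simp)
    have ny : y ∉ C := fun h => hCF' y h (by simp)
    have nv : v ∉ C := fun h => hCF' v h (by simp)
    have np : p ∉ C := fun h => hCF' p h (by simp)
    have nq : q ∉ C := fun h => hCF' q h (by simp)
    have hCn : ∀ u ∈ C, ∀ w, G.Adj u w → w ∈ C ∨ w = x ∨ w = y ∨ w = v ∨ w = p ∨ w = q := by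
      intro u hu w huw
      by_cases hw : w = x ∨ w = y ∨ w = v ∨ w = p ∨ w = q
      · exact Or.inr hw
      · left
        have hadj : G'.Adj w u :=
          ⟨huw.symm, Finset.mem_filter.2 ⟨Finset.mem_univ _, hw⟩, hCF u hu⟩
        have hr : G'.Reachable u z := SimpleGraph.ConnectedComponent.exact hu
        exact SimpleGraph.ConnectedComponent.sound (hadj.reachable.trans hr)
    have ih' : ∀ T : Finset V, T.card < S.card → 3 ≤ T.card → ec (res G T) + 4 ≤ 2 * T.card := by
      intro T hT hT3
      exact ih (res G T) T (by omega) hT3 (fun a b h => h.2.1) (fun a b h => hc _ _ h.1)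
        (fun h => hK (minor_mono K33_iso (show res G T ≤ G from fun a b h => h.1) h))
    have fin : ec G + 4 ≤ 2 * S.card := by
      by_cases hp0 : ∃ t ∈ C, G.Adj t p
      · by_cases hq0 : ∃ t ∈ C, G.Adj t q
        · exact absurd (K33_of G x y v p q C hconn xy vp vq pq vx.symm xp xq vy.symm yp yq
            ⟨z, zC, vz.symm⟩ hp0 hq0 nx ny nv np nq) hK
        · push Not at hq0
          exact sep_case G S hS x y z v p q C hCS zC hCn nx ny nv np nq xy vp vq pq
            (fun w h => (hN' w).1 h) vx vy xp xq yp yq hq0 ih'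
      · push Not at hp0
        exact sep_case G S hS x y z v q p C hCS zC
          (fun u hu w h => by have := hCn u hu w h; tauto) nx ny nv nq np xy vq vp pq.symm
          (fun w h => (hN' w).1 h) vx vy xq xp yq yp hp0 ih'
    omega

theorem degen [DecidableEq V]
    (G : SimpleGraph V) [DecidableRel G.Adj] (hG : IsPlanar G)
    (A B : Finset V) (hpart : ∀ v, v ∈ A ↔ v ∉ B)
    (hbip : ∀ u v, G.Adj u v → (u ∈ A ∧ v ∈ B) ∨ (u ∈ B ∧ v ∈ A))
    (b : ℕ) (hb : 0 < b) (hdegA : ∀ v ∈ A, G.degree v ≤ b) (T : Finset V) (hT : T ⊆ B)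
    (hne : T.Nonempty) :
    ∃ v ∈ T, (T.filter (fun u => u ≠ v ∧ ∃ a ∈ A, G.Adj a u ∧ G.Adj a v)).card < 6 * b := by
  classical
  let NT : V → Finset V := fun a => T.filter (fun u => G.Adj a u)
  let A3 : Finset V := A.filter (fun a => 3 ≤ (NT a).card)
  have hNTb : ∀ a ∈ A, (NT a).card ≤ b := by
    intro a ha
    refine le_trans (Finset.card_le_card ?_) (hdegA a ha)
    intro u hu
    rw [SimpleGraph.mem_neighborFinset]
    exact (Finset.mem_filter.1 hu).2
  have hTA : ∀ u ∈ T, u ∉ A := fun u hu h => (hpart u).1 h (hT hu)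
  -- large vertices
  let D := ∑ a ∈ A3, (NT a).card
  have hD : D ≤ 6 * T.card := by
    rcases A3.eq_empty_or_nonempty with h0 | ⟨a0, ha0⟩
    · simp [D, h0]
    let G3 : SimpleGraph V :=
      { Adj := fun u v => G.Adj u v ∧ ((u ∈ A3 ∧ v ∈ T) ∨ (u ∈ T ∧ v ∈ A3))
        symm := ⟨fun u v h => ⟨h.1.symm, by tauto⟩⟩
        loopless := ⟨fun u h => G.loopless.irrefl u h.1⟩ }
    have hT3 : 3 ≤ T.card :=
      (Finset.mem_filter.1 ha0).2.trans (Finset.card_le_card (Finset.filter_subset _ _))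
    have hU : T.card ≤ (A3 ∪ T).card := Finset.card_le_card Finset.subset_union_right
    have hU2 : (A3 ∪ T).card ≤ A3.card + T.card := Finset.card_union_le _ _
    have h1 := bip (fun u => decide (u ∈ A)) (A3 ∪ T).card G3 (A3 ∪ T) le_rfl (by omega)
      (fun u v h => by
        rw [Finset.mem_union]
        rcases h.2 with h | h
        · exact Or.inl h.1
        · exact Or.inr h.1)
      (fun u v h => by
        have hu := hpart u
        have hv := hpart v
        have := hbip u v h.1
        by_cases h1 : u ∈ A <;> by_cases h2 : v ∈ A <;> simp_all)
      (fun h => hG.2 (minor_mono K33_iso (show G3 ≤ G from fun a b h => h.1) h))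
    have h2 : D ≤ ec G3 := by
      have e1 : D = (A3.sigma NT).card := by rw [Finset.card_sigma]
      have e2 : ec G3 = G3.edgeSet.toFinset.card := by
        unfold ec; rw [Set.ncard_eq_toFinset_card']
      rw [e1, e2]
      refine Finset.card_le_card_of_injOn (fun p => s(p.1, p.2)) ?_ ?_
      · rintro ⟨a, t⟩ hp
        have hp' := Finset.mem_sigma.1 hp
        have ht := Finset.mem_filter.1 hp'.2
        simp only [Set.coe_toFinset, SimpleGraph.mem_edgeSet]
        exact ⟨ht.2, Or.inl ⟨hp'.1, ht.1⟩⟩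
      · rintro ⟨a, t⟩ hp ⟨a', t'⟩ hp' h
        have q := Finset.mem_sigma.1 hp
        have q' := Finset.mem_sigma.1 hp'
        have ht := Finset.mem_filter.1 q.2
        have ht' := Finset.mem_filter.1 q'.2
        have ha := Finset.mem_filter.1 q.1
        simp only [Sym2.eq_iff] at h
        rcases h with ⟨h1, h2⟩ | ⟨h1, h2⟩
        · subst h1; subst h2; rfl
        · exact absurd ha.1 (by rw [h1]; exact hTA _ ht'.1)
    have h3 : A3.card * 3 ≤ D := by
      have := Finset.card_nsmul_le_sum A3 (fun a => (NT a).card) 3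
        (fun a ha => (Finset.mem_filter.1 ha).2)
      simpa using this
    omega
  -- small vertices
  let J : SimpleGraph V :=
    { Adj := fun u w => u ≠ w ∧ u ∈ T ∧ w ∈ T ∧ ∃ a ∈ A, NT a = {u, w}
      symm := ⟨fun u w h => ⟨h.1.symm, h.2.2.1, h.2.1, by
        obtain ⟨a, ha, h'⟩ := h.2.2.2
        exact ⟨a, ha, by rw [h', Finset.pair_comm]⟩⟩⟩
      loopless := ⟨fun u h => h.1 rfl⟩ }
  have hown : ∀ a, ∃ o, (NT a).Nonempty → o ∈ NT a := by
    intro a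
    by_cases h : (NT a).Nonempty
    · exact ⟨h.choose, fun _ => h.choose_spec⟩
    · exact ⟨a, fun h' => absurd h' h⟩
  choose owner howner using hown
  have hJ : ¬ IsMinor (⊤ : SimpleGraph (Fin 5)) J := by
    intro hm
    refine hG.1 (minor_trans K5_iso hm
      (fun u => {t | t = u ∨ (t ∈ A ∧ (NT t).Nonempty ∧ owner t = u)}) ?_ ?_ ?_)
    · rintro u ⟨t, ht⟩
      refine conn_star G _ u (Or.inl rfl) ?_
      rintro a (rfl | ⟨h1, h2, rfl⟩)
      · exact Or.inl rfl
      · exact Or.inr (Finset.mem_filter.1 (howner a h2)).2.symm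
    · rintro u w ⟨t, ht⟩ ⟨t', ht'⟩ huw
      rw [Set.disjoint_left]
      rintro s (rfl | ⟨h1, h2, h3⟩) (h4 | ⟨h4, h5, h6⟩)
      · exact huw h4
      · exact hTA _ ht.2.1 h4
      · exact hTA _ ht'.2.1 (h4 ▸ h1)
      · exact huw (h3.symm.trans h6)
    · rintro u w ⟨huw, hu, hw, a, ha, hNa⟩
      have hne : (NT a).Nonempty := by rw [hNa]; simp
      have ho := howner a hne
      have hau : G.Adj a u := (Finset.mem_filter.1 (show u ∈ NT a by rw [hNa]; simp)).2
      have haw : G.Adj a w := (Finset.mem_filter.1 (show w ∈ NT a by rw [hNa]; simp)).2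
      rw [hNa] at ho
      simp only [Finset.mem_insert, Finset.mem_singleton] at ho
      rcases ho with ho | ho
      · exact ⟨a, Or.inr ⟨ha, hne, ho⟩, w, Or.inl rfl, haw⟩
      · exact ⟨u, Or.inl rfl, a, Or.inr ⟨ha, hne, ho⟩, hau.symm⟩
  have hE := mader T.card J T le_rfl hne (fun u v h => h.2.1) hJ
  have hsJ := sum_dg J T (fun u v h => h.2.1)
  by_contra! hcon
  have hbound : ∀ v ∈ T, 6 * b ≤ (A3.filter (fun a => G.Adj a v)).card * (b - 1) + dg J v := by
    intro v hv
    refine (hcon v hv).trans ?_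
    have hsub : T.filter (fun u => u ≠ v ∧ ∃ a ∈ A, G.Adj a u ∧ G.Adj a v) ⊆
        (A3.filter (fun a => G.Adj a v)).biUnion (fun a => (NT a).erase v) ∪
          (J.neighborSet v).toFinset := by
      intro u hu
      obtain ⟨huT, huv, a, ha, hau, hav⟩ := Finset.mem_filter.1 hu
      have hu' : u ∈ NT a := Finset.mem_filter.2 ⟨huT, hau⟩
      have hv' : v ∈ NT a := Finset.mem_filter.2 ⟨hv, hav⟩
      rw [Finset.mem_union]
      by_cases h3 : 3 ≤ (NT a).card
      · left
        exact Finset.mem_biUnion.2 ⟨a, Finset.mem_filter.2 ⟨Finset.mem_filter.2 ⟨ha, h3⟩, hav⟩,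
          Finset.mem_erase.2 ⟨huv, hu'⟩⟩
      · right
        rw [Set.mem_toFinset]
        refine ⟨huv.symm, hv, huT, a, ha, ?_⟩
        symm
        apply Finset.eq_of_subset_of_card_le
        · intro t ht
          simp only [Finset.mem_insert, Finset.mem_singleton] at ht
          rcases ht with rfl | rfl <;> assumption
        · rw [Finset.card_pair huv.symm]; omega
    refine (Finset.card_le_card hsub).trans ((Finset.card_union_le _ _).trans ?_)
    apply add_le_add
    · apply Finset.card_biUnion_le_card_mul
      intro a ha
      obtain ⟨ha3, hav⟩ := Finset.mem_filter.1 ha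
      have hv' : v ∈ NT a := Finset.mem_filter.2 ⟨hv, hav⟩
      rw [Finset.card_erase_of_mem hv']
      have := hNTb a (Finset.mem_filter.1 ha3).1
      omega
    · unfold dg; rw [Set.ncard_eq_toFinset_card']
  have hsum := Finset.sum_le_sum hbound
  rw [Finset.sum_add_distrib, hsJ, Finset.sum_const, smul_eq_mul, ← Finset.sum_mul] at hsum
  have hdc : ∑ v ∈ T, (A3.filter (fun a => G.Adj a v)).card = D :=
    (Finset.sum_card_bipartiteAbove_eq_sum_card_bipartiteBelow (s := A3) (t := T)
      (fun a v => G.Adj a v)).symm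
  rw [hdc] at hsum
  obtain ⟨b', rfl⟩ : ∃ b', b = b' + 1 := ⟨b - 1, by omega⟩
  simp only [Nat.add_sub_cancel] at hsum
  have : D * b' ≤ 6 * T.card * b' := Nat.mul_le_mul_right _ hD
  nlinarith

theorem greedy [DecidableEq V] (R : V → V → Prop) (hR : ∀ u v, R u v → R v u) (B : Finset V)
    (k : ℕ)
    (h : ∀ T ⊆ B, T.Nonempty → ∃ v ∈ T, ∀ F : Finset V, (∀ u ∈ F, u ∈ T ∧ u ≠ v ∧ R u v) →
      F.card < k) :
    ∃ c : V → ℕ, (∀ v ∈ B, c v ∈ Finset.Icc 1 k) ∧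
      (∀ u ∈ B, ∀ v ∈ B, u ≠ v → R u v → c u ≠ c v) := by
  classical
  induction B using Finset.strongInduction with
  | H B ih =>
    rcases B.eq_empty_or_nonempty with rfl | hne
    · exact ⟨fun _ => 1, by simp, by simp⟩
    obtain ⟨v, hv, hF⟩ := h B subset_rfl hne
    obtain ⟨c, h1, h2⟩ := ih (B.erase v) (Finset.erase_ssubset hv)
      (fun T hT => h T (hT.trans (Finset.erase_subset _ _)))
    have hcard := hF (B.filter (fun u => u ≠ v ∧ R u v)) (fun u hu => Finset.mem_filter.1 hu)
    obtain ⟨i, hi, hni⟩ : ∃ i ∈ Finset.Icc 1 k,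
        i ∉ (B.filter (fun u => u ≠ v ∧ R u v)).image c := by
      apply Finset.exists_mem_notMem_of_card_lt_card
      refine lt_of_le_of_lt Finset.card_image_le ?_
      simpa using hcard
    have key : ∀ u ∈ B, u ≠ v → R u v → c u ≠ i := by
      intro u hu huv hr hcu
      exact hni (Finset.mem_image.2 ⟨u, Finset.mem_filter.2 ⟨hu, huv, hr⟩, hcu⟩)
    refine ⟨Function.update c v i, ?_, ?_⟩
    · intro u hu
      by_cases huv : u = v
      · subst huv; simpa using hi
      · rw [Function.update_of_ne huv]; exact h1 u (Finset.mem_erase.2 ⟨huv, hu⟩)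
    · intro u hu w hw huw hr
      by_cases huv : u = v
      · subst huv
        rw [Function.update_self, Function.update_of_ne huw.symm]
        exact (key w hw huw.symm (hR _ _ hr)).symm
      · by_cases hwv : w = v
        · subst hwv
          rw [Function.update_self, Function.update_of_ne huv]
          exact key u hu huv hr
        · rw [Function.update_of_ne huv, Function.update_of_ne hwv]
          exact h2 u (Finset.mem_erase.2 ⟨huv, hu⟩) w (Finset.mem_erase.2 ⟨hwv, hw⟩) huw hr

end BPC

/-- if `G` is a bipartite planar graph with parts `A`, `B` and every
vertex of `A` has degree at most `b`, then `B` can be colored with `6b` colors so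
that vertices of `B` sharing a common neighbor in `A` get distinct colors. -/
theorem bipartite_planar_coloring {V : Type*} [Fintype V] [DecidableEq V]
    (G : SimpleGraph V) [DecidableRel G.Adj] (hG : IsPlanar G)
    (A B : Finset V) (hpart : ∀ v, v ∈ A ↔ v ∉ B)
    (hbip : ∀ u v, G.Adj u v → (u ∈ A ∧ v ∈ B) ∨ (u ∈ B ∧ v ∈ A))
    (b : ℕ) (hb : 0 < b) (hdegA : ∀ v ∈ A, G.degree v ≤ b) :
    ∃ c : V → ℕ,
      (∀ v ∈ B, c v ∈ Finset.Icc 1 (6 * b)) ∧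
      (∀ u ∈ B, ∀ v ∈ B, u ≠ v → (∃ a ∈ A, G.Adj a u ∧ G.Adj a v) → c u ≠ c v) := by
  classical
  refine BPC.greedy (fun u v => ∃ a ∈ A, G.Adj a u ∧ G.Adj a v)
    (fun u v ⟨a, ha, h1, h2⟩ => ⟨a, ha, h2, h1⟩) B (6 * b) ?_
  intro T hT hne
  obtain ⟨v, hv, h⟩ := BPC.degen G hG A B hpart hbip b hb hdegA T hT hne
  refine ⟨v, hv, fun F hF => lt_of_le_of_lt (Finset.card_le_card ?_) h⟩
  intro u hu
  exact Finset.mem_filter.2 (hF u hu)
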